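/- Let G be a finite p-group such that the intersection of all non-normal subgroups of G is non-trivial (and G has at least one non-normal subgroup). Then p = 2. -/

import Mathlib

theorem aux_comm {G : Type*} [Group G] {a b c : G} (hc : c ∈ Subgroup.center G)
    (h : a * b = c * (b * a)) (N : ℕ) : a * b ^ N = c ^ N * (b ^ N * a) := by
  have hb : ∀ g, g * c = c * g := Subgroup.mem_center_iff.1 hc
  induction N with
  | zero => simp
  | succ N ih =>
    have hcb : b ^ N * c = c * b ^ N := hb _
    calc a * b ^ (N+1) = (a * b ^ N) * b := by rw [pow_succ, mul_assoc]
      _ = c ^ N * (b ^ N * (a * b)) := by rw [ih]; simp only [mul_assoc]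
      _ = c ^ N * ((b ^ N * c) * (b * a)) := by rw [h]; simp only [mul_assoc]
      _ = _ := by rw [hcb]; simp only [mul_assoc, pow_succ]

theorem aux_pow {G : Type*} [Group G] {a b c : G} (hc : c ∈ Subgroup.center G)
    (h : a * b = c * (b * a)) (N : ℕ) : (a * b) ^ N * c ^ (N.choose 2) = a ^ N * b ^ N := by
  have hb : ∀ (k : ℕ) g, g * c ^ k = c ^ k * g := fun k =>
    Subgroup.mem_center_iff.1 (Subgroup.pow_mem _ hc k)
  induction N with
  | zero => simp
  | succ N ih =>
    have e : (N+1).choose 2 = N.choose 2 + N := by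
      rw [Nat.choose_succ_succ' N 1]; simp [add_comm]
    calc (a * b) ^ (N+1) * c ^ ((N+1).choose 2)
        = (a*b)^N * ((a * b) * c ^ (N.choose 2)) * c ^ N := by
          rw [e, pow_add c, pow_succ (a * b)]; simp only [mul_assoc]
      _ = ((a*b)^N * c ^ (N.choose 2)) * ((a * b) * c ^ N) := by
          rw [hb (N.choose 2) (a * b)]; simp only [mul_assoc]
      _ = a ^ N * b ^ N * (c ^ N * (a * b)) := by rw [ih, hb N]
      _ = a ^ N * ((b ^ N * c ^ N) * a) * b := by simp only [mul_assoc]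
      _ = a ^ N * (c ^ N * (b ^ N * a)) * b := by rw [hb N]; simp only [mul_assoc]
      _ = _ := by rw [← aux_comm hc h N, pow_succ, pow_succ]; simp only [mul_assoc]

theorem aux_zp {G : Type*} [Group G] {p : ℕ} (hp : p.Prime) {w x : G} (hx : orderOf x = p)
    (hw : w ≠ 1) (h : w ∈ Subgroup.zpowers x) : Subgroup.zpowers x = Subgroup.zpowers w := by
  obtain ⟨k, rfl⟩ := h
  have h1 : ¬ ((p : ℤ) ∣ k) := fun hd => hw (by
    apply orderOf_dvd_iff_zpow_eq_one.1; rwa [hx])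
  have h2 : IsCoprime k (p : ℤ) :=
    ((Prime.coprime_iff_not_dvd (Nat.prime_iff_prime_int.1 hp)).2 h1).symm
  obtain ⟨u, v, huv⟩ := h2
  apply le_antisymm
  · rw [Subgroup.zpowers_le]
    refine ⟨u, ?_⟩
    have : x ^ (u * k + v * p) = x := by rw [huv, zpow_one]
    rw [zpow_add, mul_comm v, zpow_mul x p, zpow_natCast, ← hx, pow_orderOf_eq_one, one_zpow,
      mul_one, mul_comm, zpow_mul] at this
    exact this
  · rw [Subgroup.zpowers_le]; exact ⟨k, rfl⟩

theorem aux_top {G : Type*} [Group G] {p : ℕ} (hp : p.Prime) {w x : G} {n : ℕ}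
    (hx : orderOf x = p ^ (n+1)) (hw : orderOf w = p) (h : w ∈ Subgroup.zpowers x) :
    Subgroup.zpowers (x ^ p ^ n) = Subgroup.zpowers w := by
  have h0 : orderOf (x ^ p ^ n) = p := by
    have := orderOf_pow_of_dvd (x := x) (n := p ^ n) (pow_ne_zero _ hp.ne_zero)
      (by rw [hx]; exact pow_dvd_pow _ (Nat.le_succ _))
    rw [this, hx, pow_succ, Nat.mul_div_cancel_left _ (pow_pos hp.pos _)]
  apply aux_zp hp h0
  · rintro rfl; simp at hw; exact hp.one_lt.ne hw
  obtain ⟨k, rfl⟩ := h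
  have : (x ^ k) ^ p = 1 := by rw [← hw]; exact pow_orderOf_eq_one _
  rw [← zpow_natCast, ← zpow_mul, ← orderOf_dvd_iff_zpow_eq_one, hx] at this
  push_cast at this
  rw [pow_succ] at this
  obtain ⟨j, rfl⟩ := Int.dvd_of_mul_dvd_mul_right (by exact_mod_cast hp.ne_zero) this
  refine ⟨j, ?_⟩
  simp only [← zpow_natCast, ← zpow_mul]; push_cast; rfl

/-- cyclic subgroup containing c or z -/
theorem aux_T {G : Type*} [Group G] {p : ℕ} (hp : p.Prime) {z : G}
    (hzo : orderOf z = p) (hzc : z ∈ Subgroup.center G)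
    (hz : ∀ H : Subgroup G, ¬ H.Normal → z ∈ H) {a b c : G} (hc : c ∈ Subgroup.center G)
    (hco : orderOf c = p)
    (h : a * b = c * (b * a)) {n : ℕ} (hn : orderOf a = p ^ (n+1)) :
    n ≠ 0 ∧ (Subgroup.zpowers (a ^ p ^ n) = Subgroup.zpowers c ∨
      Subgroup.zpowers (a ^ p ^ n) = Subgroup.zpowers z) := by
  have key : (Subgroup.zpowers (a ^ p ^ n) = Subgroup.zpowers c ∨
      Subgroup.zpowers (a ^ p ^ n) = Subgroup.zpowers z) := by
    by_cases hN : (Subgroup.zpowers a).Normal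
    · left
      apply aux_top hp hn hco
      have h1 := hN.conj_mem a⁻¹ (inv_mem (Subgroup.mem_zpowers a)) b
      have h2 := mul_mem (Subgroup.mem_zpowers a) h1
      have : c = a * (b * a⁻¹ * b⁻¹) := by
        have : c = (a * b) * (b * a)⁻¹ := by rw [h]; group
        rw [this]; group
      rwa [this]
    · right
      exact aux_top hp hn hzo (hz _ hN)
  refine ⟨?_, key⟩
  rintro rfl
  simp only [pow_zero, pow_one] at key
  have ha : a ∈ Subgroup.center G := by
    rcases key with e | e
    · exact (Subgroup.zpowers_le.2 hc) (e ▸ Subgroup.mem_zpowers a)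
    · exact (Subgroup.zpowers_le.2 hzc) (e ▸ Subgroup.mem_zpowers a)
  have := Subgroup.mem_center_iff.1 ha b
  rw [this] at h
  have : c = 1 := by simpa using h
  rw [this] at hco; simp at hco; exact hp.one_lt.ne hco

theorem aux_main {G : Type*} [Group G] {p : ℕ} (hp : p.Prime) (hp2 : p ≠ 2) {z : G}
    (hzo : orderOf z = p) (hzc : z ∈ Subgroup.center G)
    (hz : ∀ H : Subgroup G, ¬ H.Normal → z ∈ H) {a b c : G} (hc : c ∈ Subgroup.center G)
    (hco : orderOf c = p)
    (h : a * b = c * (b * a)) {n m : ℕ} (hn : orderOf a = p ^ (n+1)) (hm : orderOf b = p ^ (m+1))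
    (hnm : n ≤ m)
    (hmin : ∀ a' : G, a' * b = c * (b * a') → orderOf a ≤ orderOf a') : False := by
  obtain ⟨hn0, hA⟩ := aux_T hp hzo hzc hz hc hco h hn
  have h' : b * a = c⁻¹ * (a * b) := by rw [h]; group
  obtain ⟨hm0, hB⟩ := aux_T hp hzo hzc hz (inv_mem hc) (by simpa using hco) h' hm
  rw [Subgroup.zpowers_inv] at hB
  have hcj : ∀ g, g * c = c * g := Subgroup.mem_center_iff.1 hc
  have hcomm : ∀ j : ℕ, (a * b ^ j) * b = c * (b * (a * b ^ j)) := by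
    intro j
    rw [mul_assoc, ← pow_succ, pow_succ', ← mul_assoc, h]; simp only [mul_assoc]
  -- power formula
  have hpow : ∀ j : ℕ, ∀ k, k ≠ 0 → (a * b ^ j) ^ p ^ k = a ^ p ^ k * (b ^ j) ^ p ^ k := by
    intro j k hk
    rw [← aux_pow (Subgroup.pow_mem _ hc j) (aux_comm hc h j)]
    have hd : p ∣ (p ^ k).choose 2 := by
      have h2 : p ∣ (p ^ k).choose 2 * 2 := by
        have : (p ^ k).choose 2 * 2 = p ^ k * (p ^ k - 1) := by
          rw [Nat.choose_two_right]
          exact Nat.div_mul_cancel (Nat.even_mul_pred_self _).two_dvd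
        rw [this]
        exact Dvd.dvd.mul_right (dvd_pow_self _ hk) _
      rcases hp.dvd_mul.1 h2 with h3 | h3
      · exact h3
      · exact absurd ((Nat.prime_dvd_prime_iff_eq hp Nat.prime_two).1 h3) hp2
    have : (c ^ j) ^ (p ^ k).choose 2 = 1 := by
      rw [← pow_mul]
      apply orderOf_dvd_iff_pow_eq_one.1
      rw [hco]; exact hd.mul_left _
    rw [this, mul_one]
  set A := a ^ p ^ n with hAd
  set B := b ^ p ^ m with hBd
  have hAB : ∀ k : ℕ, (a * b ^ (k * p ^ (m - n))) ^ p ^ n = A * B ^ k := by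
    intro k
    rw [hpow _ _ hn0, hBd, ← pow_mul, ← pow_mul, mul_assoc, ← pow_add, Nat.sub_add_cancel hnm,
      mul_comm]
  have hne : ∀ k : ℕ, A * B ^ k ≠ 1 := by
    intro k hk
    rw [← hAB k] at hk
    have h1 := hmin _ (hcomm (k * p ^ (m - n)))
    have h2 := Nat.le_of_dvd (pow_pos hp.pos _) (orderOf_dvd_of_pow_eq_one hk)
    rw [hn] at h1
    have := Nat.pow_lt_pow_right hp.one_lt (Nat.lt_add_one n)
    omega
  have hBo : orderOf B = p := by
    apply orderOf_eq_prime (hp := ⟨hp⟩)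
    · rw [hBd, ← pow_mul, ← pow_succ, ← hm, pow_orderOf_eq_one]
    · intro e
      have := Nat.le_of_dvd (pow_pos hp.pos _) (orderOf_dvd_of_pow_eq_one e)
      rw [hm] at this
      have := Nat.pow_lt_pow_right hp.one_lt (Nat.lt_add_one m)
      omega
  have hAnB : A ∉ Subgroup.zpowers B := by
    intro hmem
    have hf : IsOfFinOrder B := orderOf_pos_iff.1 (hBo ▸ hp.pos)
    have h3 := inv_mem hmem
    rw [← hf.mem_powers_iff_mem_zpowers] at h3
    obtain ⟨k, hk⟩ := h3
    exact hne k (by simp only at hk; rw [hk, mul_inv_cancel])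
  have ha'o : orderOf (a * b ^ p ^ (m - n)) = p ^ (n+1) := by
    have h1 := hAB 1
    rw [one_mul, pow_one] at h1
    apply orderOf_eq_prime_pow (hp := ⟨hp⟩)
    · rw [h1]; simpa using hne 1
    · rw [hpow _ _ (Nat.succ_ne_zero n), ← hn, pow_orderOf_eq_one, one_mul, ← pow_mul, hn,
        ← pow_add, ← Nat.add_assoc, Nat.sub_add_cancel hnm, ← hm, pow_orderOf_eq_one]
  obtain ⟨-, hC⟩ := aux_T hp hzo hzc hz hc hco (hcomm _) ha'o
  have h1 := hAB 1
  rw [one_mul, pow_one] at h1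
  rw [h1] at hC
  have hAmem := Subgroup.mem_zpowers A
  have hCmem := Subgroup.mem_zpowers (A * B)
  have hBmem := Subgroup.mem_zpowers B
  have c1 : Subgroup.zpowers A ≠ Subgroup.zpowers B := fun e => hAnB (e ▸ hAmem)
  have c2 : Subgroup.zpowers (A * B) ≠ Subgroup.zpowers B := fun e =>
    hAnB ((Subgroup.mul_mem_cancel_right _ hBmem).1 (e ▸ hCmem))
  have c3 : Subgroup.zpowers (A * B) ≠ Subgroup.zpowers A := fun e => by
    have hBA : B ∈ Subgroup.zpowers A := (Subgroup.mul_mem_cancel_left _ hAmem).1 (e ▸ hCmem)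
    have hAo : orderOf A = p := by
      apply orderOf_eq_prime (hp := ⟨hp⟩)
      · rw [hAd, ← pow_mul, ← pow_succ, ← hn, pow_orderOf_eq_one]
      · intro e; exact hne 0 (by simpa using e)
    exact c1 (aux_zp hp hAo (by intro e; rw [e] at hBo; simp at hBo; exact hp.one_lt.ne hBo) hBA)
  rcases hA with hA | hA <;> rcases hB with hB | hB <;> rcases hC with hC | hC <;>
    simp_all

theorem aux_order {G : Type*} [Group G] [Finite G] {p : ℕ} (hp : p.Prime) (hG : IsPGroup p G)
    {x : G} (hx : x ≠ 1) : ∃ n, orderOf x = p ^ (n+1) := by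
  have : Fact p.Prime := ⟨hp⟩
  obtain ⟨k, hk⟩ := IsPGroup.iff_orderOf.1 hG x
  cases k with
  | zero => exact absurd (orderOf_eq_one_iff.1 (by simpa using hk)) hx
  | succ k => exact ⟨k, hk⟩

theorem aux_orderp {G : Type*} [Group G] [Finite G] {p : ℕ} (hp : p.Prime)
    {x : G} {n : ℕ} (hx : orderOf x = p ^ (n+1)) : orderOf (x ^ p ^ n) = p := by
  have := orderOf_pow_of_dvd (x := x) (n := p ^ n) (pow_ne_zero _ hp.ne_zero)
      (by rw [hx]; exact pow_dvd_pow _ (Nat.le_succ _))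
  rw [this, hx, pow_succ, Nat.mul_div_cancel_left _ (pow_pos hp.pos _)]

theorem aux_noncomm {G : Type*} [Group G] [Finite G] {p : ℕ} (hp : p.Prime) (hG : IsPGroup p G)
    (hne : ∃ H : Subgroup G, ¬ H.Normal) : ∃ a b c : G, c ∈ Subgroup.center G ∧ orderOf c = p ∧
      a * b = c * (b * a) := by
  have : Fact p.Prime := ⟨hp⟩
  have hnt : Nontrivial (G ⧸ Subgroup.center G) := by
    by_contra hcon
    rw [not_nontrivial_iff_subsingleton, QuotientGroup.subsingleton_iff] at hcon
    obtain ⟨H, hH⟩ := hne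
    refine hH ⟨fun x hx g => ?_⟩
    have : g ∈ Subgroup.center G := hcon ▸ Subgroup.mem_top g
    rw [← Subgroup.mem_center_iff.1 this x]; simpa using hx
  have := (hG.to_quotient (Subgroup.center G)).center_nontrivial
  obtain ⟨⟨q, hq⟩, hq1⟩ := exists_ne (1 : Subgroup.center (G ⧸ Subgroup.center G))
  obtain ⟨a, rfl⟩ := QuotientGroup.mk_surjective q
  have ha : a ∉ Subgroup.center G := fun h => hq1 (by
    ext; exact (QuotientGroup.eq_one_iff a).2 h)
  rw [Subgroup.mem_center_iff] at ha
  push Not at ha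
  obtain ⟨b, hb⟩ := ha
  have hc : a * b * (b * a)⁻¹ ∈ Subgroup.center G := by
    rw [← QuotientGroup.eq_one_iff]
    have := Subgroup.mem_center_iff.1 hq (b : G ⧸ Subgroup.center G)
    rw [QuotientGroup.mk_mul, QuotientGroup.mk_inv, QuotientGroup.mk_mul, QuotientGroup.mk_mul,
      this, mul_inv_cancel]
  have hc1 : a * b * (b * a)⁻¹ ≠ 1 := fun e => hb (mul_inv_eq_one.1 e).symm
  obtain ⟨n, hn⟩ := aux_order hp hG hc1
  set c := a * b * (b * a)⁻¹ with hcd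
  have hrel : a * b = c * (b * a) := by rw [hcd]; group
  exact ⟨a, b ^ p ^ n, c ^ p ^ n, Subgroup.pow_mem _ hc _, aux_orderp hp hn, aux_comm hc hrel _⟩

theorem aux_z {G : Type*} [Group G] [Finite G] {p : ℕ} (hp : p.Prime) (hG : IsPGroup p G)
    (N : Subgroup G) [hN : N.Normal] (hb : N ≠ ⊥) :
    ∃ z ∈ N, z ∈ Subgroup.center G ∧ orderOf z = p := by
  have : Fact p.Prime := ⟨hp⟩
  have h1 : p ∣ Nat.card N := by
    have : Nontrivial N := (Subgroup.nontrivial_iff_ne_bot N).2 hb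
    obtain ⟨k, hk, e⟩ := (hG.to_subgroup N).nontrivial_iff_card.1 inferInstance
    rw [e]; exact dvd_pow_self _ hk.ne'
  have hG' : IsPGroup p (ConjAct G) := hG
  obtain ⟨b, hb, hb1⟩ := hG'.exists_fixed_point_of_prime_dvd_card_of_fixed_point N h1
    (a := 1) (by intro g; simp)
  have hbc : (b : G) ∈ Subgroup.center G := by
    rw [Subgroup.mem_center_iff]
    intro g
    have := congrArg Subtype.val (hb (ConjAct.toConjAct g))
    rw [ConjAct.Subgroup.val_conj_smul, ConjAct.smul_def, ConjAct.ofConjAct_toConjAct] at this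
    exact mul_inv_eq_iff_eq_mul.1 this
  obtain ⟨n, hn⟩ := aux_order hp hG (x := (b : G)) (fun e => hb1 (by ext; exact e.symm))
  exact ⟨(b:G) ^ p ^ n, N.pow_mem b.2 _, Subgroup.pow_mem _ hbc _, aux_orderp hp hn⟩

/-- If a finite `p`-group has a non-normal subgroup and the intersection of all its
non-normal subgroups is non-trivial, then `p = 2`. -/
theorem stmt_10 (p : ℕ) (hp : p.Prime) (G : Type*) [Group G] [Finite G]
    (hG : IsPGroup p G)
    (hne : ∃ H : Subgroup G, ¬ H.Normal)
    (hint : sInf {H : Subgroup G | ¬ H.Normal} ≠ ⊥) :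
    p = 2 := by
  by_contra hp2
  have hRn : (sInf {H : Subgroup G | ¬ H.Normal}).Normal := by
    refine ⟨fun x hx g => ?_⟩
    rw [Subgroup.mem_sInf] at hx ⊢
    intro H hH
    have h1 : ¬ (H.comap (MulAut.conj g).toMonoidHom).Normal := by
      intro hN
      apply hH
      have h2 := hN.map (MulAut.conj g).toMonoidHom (MulAut.conj g).surjective
      rwa [Subgroup.map_comap_eq_self_of_surjective (MulAut.conj g).surjective] at h2
    have := hx _ h1
    simpa using this
  obtain ⟨z, hzR, hzc, hzo⟩ := aux_z hp hG _ hint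
  have hz : ∀ H : Subgroup G, ¬ H.Normal → z ∈ H := fun H hH => Subgroup.mem_sInf.1 hzR H hH
  let S : Set ℕ := {s | ∃ a b c : G, c ∈ Subgroup.center G ∧ orderOf c = p ∧
      a * b = c * (b * a) ∧ orderOf a + orderOf b = s}
  have hS : S.Nonempty := by
    obtain ⟨a, b, c, h1, h2, h3⟩ := aux_noncomm hp hG hne
    exact ⟨_, a, b, c, h1, h2, h3, rfl⟩
  obtain ⟨a, b, c, hc, hco, h, hs⟩ := Nat.sInf_mem hS
  have hmin : ∀ a' b' c' : G, c' ∈ Subgroup.center G → orderOf c' = p →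
      a' * b' = c' * (b' * a') → orderOf a + orderOf b ≤ orderOf a' + orderOf b' := by
    intro a' b' c' h1 h2 h3
    rw [hs]; exact Nat.sInf_le ⟨a', b', c', h1, h2, h3, rfl⟩
  have hc1 : c ≠ 1 := by rintro rfl; simp at hco; exact hp.one_lt.ne hco
  have ha : a ≠ 1 := by rintro rfl; exact hc1 (by simpa using h)
  have hb : b ≠ 1 := by rintro rfl; exact hc1 (by simpa using h)
  obtain ⟨n, hn⟩ := aux_order hp hG ha
  obtain ⟨m, hm⟩ := aux_order hp hG hb
  have h' : b * a = c⁻¹ * (a * b) := by rw [h]; group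
  have hco' : orderOf c⁻¹ = p := by simpa using hco
  rcases le_total n m with hnm | hnm
  · refine aux_main hp hp2 hzo hzc hz hc hco h hn hm hnm fun a' e => ?_
    have := hmin a' b c hc hco e
    omega
  · refine aux_main hp hp2 hzo hzc hz (inv_mem hc) hco' h' hm hn hnm fun a' e => ?_
    have := hmin a' a c⁻¹ (inv_mem hc) hco' e
    omega
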